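/- For every ε with 0 < ε < 2 there exists a positive integer n_0 such that for all integers n ≥ n_0, the n-th Ramanujan prime satisfies R_n > (2 − ε)·n·log n. -/

import Mathlib

/-- The `n`-th Ramanujan prime: the smallest positive integer `R` such that for every
integer `x ≥ R` we have `π(x) − π(x/2) ≥ n`, where `π` counts primes and `x/2`
is `⌊x/2⌋`. -/
noncomputable def ramanujan (n : ℕ) : ℕ :=
  sInf {R : ℕ | 0 < R ∧ ∀ x : ℕ, R ≤ x → n ≤ x.primeCounting - (x / 2).primeCounting}

open MeasureTheory Filter Set Topology

/-- The function `u ↦ ψ(eᵘ) e⁻ᵘ`. -/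
noncomputable def psiRatio (u : ℝ) : ℝ := Chebyshev.psi (Real.exp u) * Real.exp (-u)

lemma psiRatio_nonneg (u : ℝ) : 0 ≤ psiRatio u :=
  mul_nonneg (Chebyshev.psi_nonneg _) (Real.exp_pos _).le

lemma psiRatio_le (u : ℝ) : psiRatio u ≤ Real.log 4 + 4 := by
  have h := Chebyshev.psi_le_const_mul_self (Real.exp_pos u).le
  calc psiRatio u ≤ (Real.log 4 + 4) * Real.exp u * Real.exp (-u) := by
        unfold psiRatio; gcongr
    _ = Real.log 4 + 4 := by rw [mul_assoc, ← Real.exp_add]; simp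

lemma measurable_psiRatio : Measurable psiRatio :=
  (Chebyshev.psi_mono.measurable.comp Real.measurable_exp).mul (by fun_prop)

lemma psiRatio_mul_exp_neg_le (u : ℝ) {w : ℝ} (hw : 0 ≤ w) :
    psiRatio u * Real.exp (-w) ≤ psiRatio (u + w) := by
  unfold psiRatio
  rw [mul_assoc, ← Real.exp_add, neg_add]
  have h : Chebyshev.psi (Real.exp u) ≤ Chebyshev.psi (Real.exp (u + w)) :=
    Chebyshev.psi_mono (Real.exp_le_exp.2 (by linarith))
  gcongr

lemma psiRatio_of_nonpos {u : ℝ} (hu : u ≤ 0) : psiRatio u = 0 := by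
  simp [psiRatio, Chebyshev.psi_eq_zero_of_le_one (Real.exp_le_one_iff.2 hu)]

lemma LSeries_vonMangoldt_eq_mul_integral {s : ℂ} (hs : 1 < s.re) :
    LSeries (fun n ↦ (ArithmeticFunction.vonMangoldt n : ℂ)) s =
      s * ∫ u in Ioi (0 : ℝ), (psiRatio u : ℂ) * Complex.exp (-(s - 1) * u) := by
  rw [LSeries_eq_mul_integral_of_nonneg (fun n ↦ ArithmeticFunction.vonMangoldt n) zero_le_one hs
    _ (fun _ ↦ ArithmeticFunction.vonMangoldt_nonneg)]
  · congr 1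
    rw [← Real.exp_zero, ← integral_comp_exp_Ioi]
    refine setIntegral_congr_fun measurableSet_Ioi fun u _ ↦ ?_
    have h1 : (∑ k ∈ Finset.Icc 1 ⌊Real.exp u⌋₊, (ArithmeticFunction.vonMangoldt k : ℂ)) =
        (Chebyshev.psi (Real.exp u) : ℂ) := by
      rw [Chebyshev.psi]
      push_cast
      rfl
    simp only [h1, psiRatio, Complex.real_smul]
    rw [Complex.cpow_def_of_ne_zero (by exact_mod_cast (Real.exp_pos u).ne'),
      ← Complex.ofReal_log (Real.exp_pos u).le, Real.log_exp]
    push_cast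
    rw [mul_left_comm, ← Complex.exp_add, mul_assoc, ← Complex.exp_add]
    ring_nf
  · refine Asymptotics.IsBigO.of_bound (Real.log 4 + 4) (Eventually.of_forall fun n ↦ ?_)
    have h := Chebyshev.psi_le_const_mul_self (Nat.cast_nonneg (α := ℝ) n)
    rw [Chebyshev.psi, Nat.floor_natCast] at h
    change ∑ k ∈ Finset.Icc 1 n, _ ≤ _ at h
    rw [Real.norm_of_nonneg (Finset.sum_nonneg fun _ _ ↦ ArithmeticFunction.vonMangoldt_nonneg)]
    simpa using h

/-- The continuous extension to `1 ≤ re s` of the Laplace transform of `ψ(eᵘ)e⁻ᵘ - 1`,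
where the transform is evaluated at `s - 1`. -/
noncomputable def psiLaplace (s : ℂ) : ℂ :=
  (-deriv (DirichletCharacter.LFunctionTrivChar₁ 1) s /
    DirichletCharacter.LFunctionTrivChar₁ 1 s - 1) / s

lemma continuousOn_psiLaplace : ContinuousOn psiLaplace {s | 1 ≤ s.re} := by
  refine ((DirichletCharacter.continuousOn_neg_logDeriv_LFunctionTrivChar₁ 1).mono
    (fun s hs ↦ ?_)).sub continuousOn_const |>.div continuousOn_id fun s hs ↦ ?_
  · right
    rw [DirichletCharacter.LFunctionTrivChar, DirichletCharacter.LFunction_modOne_eq]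
    exact riemannZeta_ne_zero_of_one_le_re hs
  · rintro rfl
    simp at hs
    linarith

lemma integral_psiRatio_sub_one {s : ℂ} (hs : 1 < s.re) :
    ∫ u in Ioi (0 : ℝ), ((psiRatio u - 1 : ℝ) : ℂ) * Complex.exp (-(s - 1) * u) =
      psiLaplace s := by
  have hre : (-(s - 1)).re < 0 := by simp; linarith
  have hs1 : s ≠ 1 := by rintro rfl; simp at hs
  have hs0 : s ≠ 0 := by rintro rfl; simp at hs; linarith
  have hexp : IntegrableOn (fun u : ℝ ↦ Complex.exp (-(s - 1) * u)) (Ioi 0) :=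
    integrableOn_exp_mul_complex_Ioi hre 0
  have hint : IntegrableOn (fun u : ℝ ↦ (psiRatio u : ℂ) * Complex.exp (-(s - 1) * u)) (Ioi 0) := by
    refine Integrable.bdd_mul (c := Real.log 4 + 4) hexp ?_ ?_
    · exact (Complex.measurable_ofReal.comp measurable_psiRatio).aestronglyMeasurable
    · refine Eventually.of_forall fun u ↦ ?_
      rw [Complex.norm_real, Real.norm_of_nonneg (psiRatio_nonneg u)]
      exact psiRatio_le u
  have hz : riemannZeta s ≠ 0 := riemannZeta_ne_zero_of_one_le_re hs.le
  have h1 : ∫ u in Ioi (0 : ℝ), (psiRatio u : ℂ) * Complex.exp (-(s - 1) * u) =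
      (-deriv riemannZeta s / riemannZeta s) / s := by
    rw [← ArithmeticFunction.LSeries_vonMangoldt_eq_deriv_riemannZeta_div hs,
      LSeries_vonMangoldt_eq_mul_integral hs]
    field_simp
  have hL : DirichletCharacter.LFunctionTrivChar 1 = riemannZeta :=
    DirichletCharacter.LFunction_modOne_eq
  have hL1 : DirichletCharacter.LFunctionTrivChar₁ 1 s = (s - 1) * riemannZeta s := by
    rw [DirichletCharacter.LFunctionTrivChar₁, Function.update_of_ne hs1, hL]
  simp only [Complex.ofReal_sub, Complex.ofReal_one, sub_mul, one_mul] at hint ⊢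
  rw [integral_sub hint hexp, h1, integral_exp_mul_complex_Ioi hre, psiLaplace, hL1,
    DirichletCharacter.deriv_LFunctionTrivChar₁_apply_of_ne_one 1 hs1, hL]
  have : s - 1 ≠ 0 := sub_ne_zero.2 hs1
  simp only [Complex.ofReal_zero, mul_zero, Complex.exp_zero]
  field_simp
  ring

/-- A slowly decreasing bounded function whose averages against all dilates of an integrable
nonnegative kernel of mass one converge to `1` itself converges to `1`. -/
lemma tendsto_one_of_tendsto_average {a k : ℝ → ℝ} {M : ℝ} (ha : Measurable a)
    (ha₀ : ∀ u, 0 ≤ a u) (haM : ∀ u, a u ≤ M)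
    (hdec : ∀ u w, 0 ≤ w → a u * Real.exp (-w) ≤ a (u + w))
    (hk₀ : ∀ x, 0 ≤ k x) (hk : Integrable k) (hk₁ : ∫ x, k x = 1)
    (hT : ∀ l : ℝ, 0 < l → Tendsto (fun v ↦ ∫ x, a (v + x / l) * k x) atTop (𝓝 1)) :
    Tendsto a atTop (𝓝 1) := by
  have hM : 0 ≤ M := (ha₀ 0).trans (haM 0)
  have hint (l v : ℝ) : Integrable fun x ↦ a (v + x / l) * k x := by
    refine hk.bdd_mul (c := M)
      (ha.comp (by fun_prop : Measurable fun x ↦ v + x / l)).aestronglyMeasurable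
      (Eventually.of_forall fun x ↦ ?_)
    rw [Real.norm_of_nonneg (ha₀ _)]
    exact haM _
  have key (η : ℝ) (hη : 0 < η) (hη1 : η < 1) : ∀ᶠ v in atTop,
      (1 - η - M * η) * Real.exp (-(2 * η)) ≤ a v ∧
        a v ≤ (1 + η) * Real.exp (2 * η) / (1 - η) := by
    obtain ⟨X, hX, hJ⟩ : ∃ X : ℝ, 0 < X ∧ 1 - η < ∫ x in Icc (-X) X, k x := by
      have h := (aecover_Icc (μ := volume) (a := fun X : ℝ ↦ -X) (b := fun X : ℝ ↦ X)
        tendsto_neg_atTop_atBot tendsto_id).integral_tendsto_of_countably_generated hk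
      rw [hk₁] at h
      exact ((eventually_gt_atTop 0).and (h.eventually_const_lt (by linarith))).exists
    set J := ∫ x in Icc (-X) X, k x with hJdef
    have hJc : (∫ x in (Icc (-X) X)ᶜ, k x) = 1 - J := by
      have := integral_add_compl (measurableSet_Icc (a := -X) (b := X)) hk
      linarith
    have hJ1 : J ≤ 1 := by
      have : 0 ≤ ∫ x in (Icc (-X) X)ᶜ, k x := integral_nonneg hk₀
      linarith
    set l := X / η with hl
    have hlpos : 0 < l := by positivity
    have hxl {x : ℝ} (hx : x ∈ Icc (-X) X) : -η ≤ x / l ∧ x / l ≤ η := by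
      rw [le_div_iff₀ hlpos, div_le_iff₀ hlpos, hl, neg_mul, mul_div_cancel₀ _ hη.ne']
      exact hx
    have hlow (v : ℝ) : a (v - η) * Real.exp (-(2 * η)) * J ≤ ∫ x, a (v + x / l) * k x := by
      calc a (v - η) * Real.exp (-(2 * η)) * J
          = ∫ x in Icc (-X) X, a (v - η) * Real.exp (-(2 * η)) * k x := by
            rw [integral_const_mul]
        _ ≤ ∫ x in Icc (-X) X, a (v + x / l) * k x := by
            refine setIntegral_mono_on (hk.integrableOn.const_mul _) (hint l v).integrableOn
              measurableSet_Icc fun x hx ↦ ?_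
            obtain ⟨h1, h2⟩ := hxl hx
            gcongr
            · exact hk₀ x
            · calc a (v - η) * Real.exp (-(2 * η))
                  ≤ a (v - η) * Real.exp (-(x / l + η)) := by
                    gcongr
                    · exact ha₀ _
                    · linarith
                _ ≤ a (v - η + (x / l + η)) := hdec _ _ (by linarith)
                _ = a (v + x / l) := by ring_nf
        _ ≤ ∫ x, a (v + x / l) * k x :=
            setIntegral_le_integral (hint l v)
              (Eventually.of_forall fun x ↦ mul_nonneg (ha₀ _) (hk₀ x))
    have hupp (v : ℝ) : ∫ x, a (v + x / l) * k x ≤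
        a (v + η) * Real.exp (2 * η) * J + M * (1 - J) := by
      rw [← integral_add_compl (measurableSet_Icc (a := -X) (b := X)) (hint l v), ← hJc, hJdef,
        ← integral_const_mul, ← integral_const_mul]
      refine add_le_add (setIntegral_mono_on (hint l v).integrableOn (hk.integrableOn.const_mul _)
        measurableSet_Icc fun x hx ↦ ?_) (integral_mono (hint l v).integrableOn
          (hk.integrableOn.const_mul _) fun x ↦ mul_le_mul_of_nonneg_right (haM _) (hk₀ x))
      obtain ⟨h1, h2⟩ := hxl hx
      gcongr
      · exact hk₀ x
      · have h3 : a (v + x / l) * Real.exp (-(η - x / l)) ≤ a (v + η) := by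
          have := hdec (v + x / l) (η - x / l) (by linarith)
          rwa [show v + x / l + (η - x / l) = v + η by ring] at this
        calc a (v + x / l)
            = a (v + x / l) * Real.exp (-(η - x / l)) * Real.exp (η - x / l) := by
              rw [mul_assoc, ← Real.exp_add]; simp
          _ ≤ a (v + η) * Real.exp (2 * η) := by
              gcongr
              · exact ha₀ _
              · linarith
    have hTl := hT l hlpos
    have e1 := (tendsto_atTop_add_const_right atTop η tendsto_id).eventually
      (hTl.eventually_le_const (show (1 : ℝ) < 1 + η by linarith))
    have e2 := (tendsto_atTop_add_const_right atTop (-η) tendsto_id).eventually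
      (hTl.eventually_const_le (show 1 - η < (1 : ℝ) by linarith))
    filter_upwards [e1, e2] with v h1 h2
    have h3 := (hlow (v + η)).trans h1
    have h4 := h2.trans (hupp (v + -η))
    rw [show v + η - η = v by ring] at h3
    rw [show v + -η + η = v by ring] at h4
    have hE : Real.exp (-(2 * η)) * Real.exp (2 * η) = 1 := by rw [← Real.exp_add]; simp
    have hE0 := Real.exp_pos (2 * η)
    constructor
    · have h5 : 1 - η - M * η ≤ a v * Real.exp (2 * η) := by
        have : a v * Real.exp (2 * η) * J ≤ a v * Real.exp (2 * η) :=
          mul_le_of_le_one_right (mul_nonneg (ha₀ v) hE0.le) hJ1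
        have : M * (1 - J) ≤ M * η := by gcongr; linarith
        linarith
      calc _ ≤ a v * Real.exp (2 * η) * Real.exp (-(2 * η)) := by gcongr
        _ = a v := by rw [mul_assoc, mul_comm (Real.exp (2 * η)), hE, mul_one]
    · rw [le_div_iff₀ (by linarith)]
      calc a v * (1 - η) ≤ a v * J := by gcongr; exact ha₀ v
        _ = a v * Real.exp (-(2 * η)) * J * Real.exp (2 * η) := by
            linear_combination (-(a v) * J) * hE
        _ ≤ _ := by gcongr
  have lim1 : Tendsto (fun η : ℝ ↦ (1 - η - M * η) * Real.exp (-(2 * η))) (𝓝[>] 0) (𝓝 1) := by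
    have : ContinuousAt (fun η : ℝ ↦ (1 - η - M * η) * Real.exp (-(2 * η))) 0 := by fun_prop
    simpa [ContinuousAt] using this.tendsto.mono_left nhdsWithin_le_nhds
  have lim2 : Tendsto (fun η : ℝ ↦ (1 + η) * Real.exp (2 * η) / (1 - η)) (𝓝[>] 0) (𝓝 1) := by
    have : ContinuousAt (fun η : ℝ ↦ (1 + η) * Real.exp (2 * η) / (1 - η)) 0 := by
      fun_prop (disch := norm_num)
    simpa [ContinuousAt] using this.tendsto.mono_left nhdsWithin_le_nhds
  have hsmall : ∀ᶠ η : ℝ in 𝓝[>] 0, 0 < η ∧ η < 1 := Ioo_mem_nhdsGT one_pos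
  refine tendsto_order.2 ⟨fun c hc ↦ ?_, fun c hc ↦ ?_⟩
  · obtain ⟨η, h1, h2, h3⟩ := ((lim1.eventually_const_lt hc).and hsmall).exists
    filter_upwards [key η h2 h3] with v hv using h1.trans_le hv.1
  · obtain ⟨η, h1, h2, h3⟩ := ((lim2.eventually_lt_const hc).and hsmall).exists
    filter_upwards [key η h2 h3] with v hv using hv.2.trans_lt h1

/-- If the Laplace transform of a bounded function `b` extends continuously to the closed half
plane, then the convolution of `b` with any integrable band-limited kernel tends to zero. -/
lemma tendsto_integral_mul_kernel_zero {b : ℝ → ℝ} {M : ℝ} (hb : Measurable b)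
    (hbM : ∀ u, |b u| ≤ M) {F : ℂ → ℂ} (hF : ContinuousOn F {s | 1 ≤ s.re})
    (hbF : ∀ s : ℂ, 1 < s.re →
      ∫ u in Ioi (0 : ℝ), (b u : ℂ) * Complex.exp (-(s - 1) * u) = F s)
    {φ : ℝ → ℂ} (hφ : Continuous φ) {R : ℝ} {K : ℝ → ℂ} (hK : Integrable K)
    (hφK : ∀ x : ℝ, x ≠ 0 → ∫ t in Icc (-R) R, φ t * Complex.exp (-(t * x * Complex.I)) = K x) :
    Tendsto (fun v ↦ ∫ u in Ioi (0 : ℝ), (b u : ℂ) * K (u - v)) atTop (𝓝 0) := by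
  have hb' : Measurable fun u ↦ (b u : ℂ) := Complex.measurable_ofReal.comp hb
  -- the Parseval identity to the right of the critical line
  have h₁ (v δ : ℝ) (hδ : 0 < δ) :
      ∫ t in Icc (-R) R, φ t * Complex.exp (t * v * Complex.I) * F (1 + δ + t * Complex.I) =
        ∫ u in Ioi (0 : ℝ), (b u : ℂ) * Real.exp (-δ * u) * K (u - v) := by
    have hprod : Integrable (Function.uncurry fun (t u : ℝ) ↦
        φ t * Real.exp (-δ * u) * (b u * Complex.exp (-(t * (u - v) * Complex.I))))
        ((volume.restrict (Icc (-R) R)).prod (volume.restrict (Ioi 0))) := by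
      have h1 : Integrable φ (volume.restrict (Icc (-R) R)) :=
        hφ.continuousOn.integrableOn_compact isCompact_Icc
      have h2 : Integrable (fun u : ℝ ↦ (Real.exp (-δ * u) : ℂ)) (volume.restrict (Ioi 0)) :=
        Integrable.ofReal (integrableOn_exp_mul_Ioi (neg_lt_zero.2 hδ) 0)
      refine (h1.mul_prod h2).mul_bdd (c := M) ?_ (Eventually.of_forall fun p ↦ ?_)
      · exact ((hb'.comp measurable_snd).mul (by fun_prop)).aestronglyMeasurable
      · have : -((p.1 : ℂ) * (p.2 - v) * Complex.I) = ((-(p.1 * (p.2 - v)) : ℝ) : ℂ) * Complex.I := by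
          push_cast; ring
        rw [norm_mul, this, Complex.norm_exp_ofReal_mul_I, mul_one, Complex.norm_real]
        exact hbM _
    have hne : ∀ᵐ u : ℝ ∂(volume.restrict (Ioi (0 : ℝ))), u ≠ v :=
      ae_restrict_of_ae (Measure.ae_ne volume v)
    calc _ = ∫ t in Icc (-R) R, ∫ u in Ioi (0 : ℝ),
          φ t * Real.exp (-δ * u) * (b u * Complex.exp (-(t * (u - v) * Complex.I))) := by
          refine integral_congr_ae (Eventually.of_forall fun t ↦ ?_)
          simp only
          rw [← hbF _ (by simpa using hδ), ← integral_const_mul]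
          refine integral_congr_ae (Eventually.of_forall fun u ↦ ?_)
          simp only [Complex.ofReal_exp]
          have : Complex.exp (t * v * Complex.I) *
              Complex.exp (-(1 + δ + t * Complex.I - 1) * u) =
              Complex.exp ((-δ * u : ℝ)) * Complex.exp (-(t * (u - v) * Complex.I)) := by
            rw [← Complex.exp_add, ← Complex.exp_add]
            push_cast
            ring_nf
          linear_combination (φ t * b u) * this
      _ = ∫ u in Ioi (0 : ℝ), ∫ t in Icc (-R) R,
          φ t * Real.exp (-δ * u) * (b u * Complex.exp (-(t * (u - v) * Complex.I))) :=
          integral_integral_swap hprod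
      _ = _ := by
          refine integral_congr_ae (hne.mono fun u hu ↦ ?_)
          simp only
          rw [← hφK (u - v) (sub_ne_zero.2 hu), ← integral_const_mul]
          refine integral_congr_ae (Eventually.of_forall fun t ↦ ?_)
          push_cast
          ring
  -- the Parseval identity on the critical line
  have h₂ (v : ℝ) :
      ∫ t in Icc (-R) R, φ t * Complex.exp (t * v * Complex.I) * F (1 + t * Complex.I) =
        ∫ u in Ioi (0 : ℝ), (b u : ℂ) * K (u - v) := by
    have hpos : ∀ᶠ δ : ℝ in 𝓝[>] 0, 0 < δ ∧ δ < 1 := Ioo_mem_nhdsGT one_pos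
    have hcont : ContinuousOn (fun p : ℝ × ℝ ↦ F (1 + p.1 + p.2 * Complex.I))
        (Icc 0 1 ×ˢ Icc (-R) R) :=
      hF.comp (by fun_prop) fun p hp ↦ by simpa using hp.1.1
    obtain ⟨B, hB⟩ := (isCompact_Icc.prod isCompact_Icc).exists_bound_of_continuousOn hcont
    obtain ⟨C, hC⟩ := (isCompact_Icc (a := -R) (b := R)).exists_bound_of_continuousOn
      hφ.continuousOn
    have hline (δ : ℝ) (hδ : 0 ≤ δ) : Continuous fun t : ℝ ↦ F (1 + δ + t * Complex.I) :=
      hF.comp_continuous (by fun_prop) fun t ↦ by simpa using hδ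
    have l1 : Tendsto (fun δ : ℝ ↦ ∫ t in Icc (-R) R,
        φ t * Complex.exp (t * v * Complex.I) * F (1 + δ + t * Complex.I)) (𝓝[>] 0)
        (𝓝 (∫ t in Icc (-R) R, φ t * Complex.exp (t * v * Complex.I) *
          F (1 + t * Complex.I))) := by
      refine tendsto_integral_filter_of_dominated_convergence (fun _ ↦ C * B) ?_ ?_ ?_ ?_
      · filter_upwards [hpos] with δ hδ
        exact ((hφ.mul (by fun_prop)).mul (hline δ hδ.1.le)).aestronglyMeasurable
      · filter_upwards [hpos] with δ hδ
        refine (ae_restrict_iff' measurableSet_Icc).2 (Eventually.of_forall fun t ht ↦ ?_)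
        have : (t : ℂ) * v * Complex.I = ((t * v : ℝ) : ℂ) * Complex.I := by push_cast; ring
        rw [norm_mul, norm_mul, this, Complex.norm_exp_ofReal_mul_I, mul_one]
        exact mul_le_mul (hC t ht) (hB (δ, t) ⟨⟨hδ.1.le, hδ.2.le⟩, ht⟩) (norm_nonneg _)
          ((norm_nonneg _).trans (hC t ht))
      · exact integrable_const _
      · refine Eventually.of_forall fun t ↦ Tendsto.const_mul _ ?_
        have h0 : ContinuousWithinAt F {s | 1 ≤ s.re} (1 + t * Complex.I) :=
          hF _ (by simp)
        refine h0.tendsto.comp (tendsto_nhdsWithin_iff.2 ⟨?_, ?_⟩)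
        · have : ContinuousAt (fun δ : ℝ ↦ (1 + δ + t * Complex.I : ℂ)) 0 := by fun_prop
          simpa [ContinuousAt] using this.tendsto.mono_left nhdsWithin_le_nhds
        · filter_upwards [hpos] with δ hδ
          simpa using hδ.1.le
    have hKv : Integrable fun u ↦ K (u - v) := hK.comp_sub_right v
    have l2 : Tendsto (fun δ : ℝ ↦ ∫ u in Ioi (0 : ℝ), (b u : ℂ) * Real.exp (-δ * u) * K (u - v))
        (𝓝[>] 0) (𝓝 (∫ u in Ioi (0 : ℝ), (b u : ℂ) * K (u - v))) := by
      refine tendsto_integral_filter_of_dominated_convergence (fun u ↦ M * ‖K (u - v)‖) ?_ ?_ ?_ ?_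
      · refine Eventually.of_forall fun δ ↦ ?_
        exact (hb'.mul (by fun_prop)).aestronglyMeasurable.mul hKv.aestronglyMeasurable.restrict
      · filter_upwards [hpos] with δ hδ
        refine (ae_restrict_iff' measurableSet_Ioi).2 (Eventually.of_forall fun u hu ↦ ?_)
        rw [norm_mul, norm_mul, Complex.norm_real, Complex.norm_real,
          Real.norm_of_nonneg (Real.exp_pos _).le]
        gcongr
        have : Real.exp (-δ * u) ≤ 1 := by
          rw [Real.exp_le_one_iff]
          nlinarith [hδ.1, mem_Ioi.1 hu, mul_pos hδ.1 hu]
        exact (mul_le_of_le_one_right (abs_nonneg _) this).trans (hbM u)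
      · exact (hKv.norm.const_mul M).integrableOn
      · refine Eventually.of_forall fun u ↦ Tendsto.mul_const _ ?_
        have : ContinuousAt (fun δ : ℝ ↦ (b u : ℂ) * Real.exp (-δ * u)) 0 := by fun_prop
        simpa [ContinuousAt] using this.tendsto.mono_left nhdsWithin_le_nhds
    refine tendsto_nhds_unique l1 (l2.congr' ?_)
    filter_upwards [hpos] with δ hδ using (h₁ v δ hδ.1).symm
  have hRL := Real.tendsto_integral_exp_smul_cocompact
    ((Icc (-R) R).indicator fun t : ℝ ↦ φ t * F (1 + t * Complex.I))
  have hw : Tendsto (fun v : ℝ ↦ -(2 * Real.pi)⁻¹ * v) atTop (cocompact ℝ) :=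
    (tendsto_id.const_mul_atTop_of_neg (by simp [Real.pi_pos])).mono_right atBot_le_cocompact
  refine (hRL.comp hw).congr fun v ↦ ?_
  rw [← h₂ v, ← integral_indicator measurableSet_Icc]
  refine integral_congr_ae (Eventually.of_forall fun t ↦ ?_)
  by_cases ht : t ∈ Icc (-R) R
  · simp only [indicator_of_mem ht, Circle.smul_def, Real.fourierChar_apply, smul_eq_mul]
    have : (2 * Real.pi * -(t * (-(2 * Real.pi)⁻¹ * v)) : ℝ) = t * v := by
      field_simp
    rw [this]
    push_cast
    ring
  · simp [indicator_of_notMem ht]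

/-- The (unnormalised) Fejér kernel. -/
noncomputable def fejerKernel (x : ℝ) : ℝ := 2 * (1 - Real.cos x) / x ^ 2

lemma fejerKernel_nonneg (x : ℝ) : 0 ≤ fejerKernel x := by
  have := Real.cos_le_one x
  unfold fejerKernel
  have : 0 ≤ 1 - Real.cos x := by linarith
  positivity

lemma measurable_fejerKernel : Measurable fejerKernel := by
  unfold fejerKernel
  fun_prop

lemma fejerKernel_le (x : ℝ) : fejerKernel x ≤ 8 * (1 + x ^ 2)⁻¹ := by
  rcases eq_or_ne x 0 with rfl | hx
  · simp [fejerKernel]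
  have h1 := Real.one_sub_sq_div_two_le_cos (x := x)
  have h2 := Real.neg_one_le_cos x
  rw [fejerKernel, ← div_eq_mul_inv, div_le_div_iff₀ (by positivity) (by positivity)]
  nlinarith [sq_nonneg x]

lemma integrable_fejerKernel : Integrable fejerKernel := by
  refine (integrable_inv_one_add_sq.const_mul 8).mono'
    measurable_fejerKernel.aestronglyMeasurable (Eventually.of_forall fun x ↦ ?_)
  rw [Real.norm_of_nonneg (fejerKernel_nonneg x)]
  exact fejerKernel_le x

lemma integral_fejerKernel_pos : 0 < ∫ x, fejerKernel x := by
  rw [integral_pos_iff_support_of_nonneg fejerKernel_nonneg integrable_fejerKernel]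
  refine (by simp : (0 : ENNReal) < volume (Ioo (0 : ℝ) 1)).trans_le (measure_mono fun x hx ↦ ?_)
  have h1 : Real.cos x < 1 := by
    rw [← Real.cos_zero]
    exact Real.cos_lt_cos_of_nonneg_of_le_pi le_rfl (by linarith [hx.2, Real.pi_gt_three]) hx.1
  have h2 : 0 < 1 - Real.cos x := by linarith
  have := hx.1
  exact (by unfold fejerKernel; positivity : 0 < fejerKernel x).ne'

/-- The Fejér kernel is the Fourier transform of a triangle function. -/
lemma integral_triangle_mul_exp {l x : ℝ} (hl : 0 < l) (hx : x ≠ 0) :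
    ∫ t in Icc (-l) l, ((1 - |t| / l : ℝ) : ℂ) * Complex.exp (-(t * x * Complex.I)) =
      ((l * fejerKernel (l * x) : ℝ) : ℂ) := by
  set c : ℂ := -(x * Complex.I) with hc
  have hc0 : c ≠ 0 := by simp [hc, hx]
  have hl0 : (l : ℂ) ≠ 0 := by exact_mod_cast hl.ne'
  have hexp (t : ℝ) : HasDerivAt (fun t : ℝ ↦ Complex.exp (c * t)) (c * Complex.exp (c * t)) t := by
    have := ((hasDerivAt_id (t : ℂ)).const_mul c).cexp.comp_ofReal
    simpa [mul_comm] using this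
  have hlin (t : ℝ) : HasDerivAt (fun t : ℝ ↦ (t : ℂ)) 1 t := by
    simpa using (hasDerivAt_id (t : ℂ)).comp_ofReal
  have hcont : Continuous fun t : ℝ ↦
      ((1 - |t| / l : ℝ) : ℂ) * Complex.exp (-(t * x * Complex.I)) := by fun_prop
  have hright : ∫ t in (0 : ℝ)..l, ((1 - |t| / l : ℝ) : ℂ) * Complex.exp (-(t * x * Complex.I)) =
      Complex.exp (c * l) / (l * c ^ 2) - (1 / c + 1 / (l * c ^ 2)) := by
    rw [intervalIntegral.integral_eq_sub_of_hasDerivAt (f := fun t : ℝ ↦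
      ((1 - t / l) / c + 1 / (l * c ^ 2)) * Complex.exp (c * t)) ?_ (hcont.intervalIntegrable _ _)]
    · simp [hl0]
      ring
    · intro t ht
      rw [uIcc_of_le hl.le] at ht
      convert! ((((hlin t).div_const (l : ℂ)).const_sub 1).div_const c |>.add_const
        (1 / (l * c ^ 2))).mul (hexp t) using 1
      rw [abs_of_nonneg ht.1, show -((t : ℂ) * x * Complex.I) = c * t by rw [hc]; ring]
      push_cast
      field_simp
      ring
  have hleft : ∫ t in (-l)..0, ((1 - |t| / l : ℝ) : ℂ) * Complex.exp (-(t * x * Complex.I)) =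
      (1 / c - 1 / (l * c ^ 2)) + Complex.exp (-(c * l)) / (l * c ^ 2) := by
    rw [intervalIntegral.integral_eq_sub_of_hasDerivAt (f := fun t : ℝ ↦
      ((1 + t / l) / c - 1 / (l * c ^ 2)) * Complex.exp (c * t)) ?_ (hcont.intervalIntegrable _ _)]
    · simp [hl0]
      ring
    · intro t ht
      rw [uIcc_of_le (by linarith)] at ht
      convert! ((((hlin t).div_const (l : ℂ)).const_add 1).div_const c |>.sub_const
        (1 / (l * c ^ 2))).mul (hexp t) using 1
      rw [abs_of_nonpos ht.2, show -((t : ℂ) * x * Complex.I) = c * t by rw [hc]; ring]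
      push_cast
      field_simp
      ring
  rw [integral_Icc_eq_integral_Ioc, ← intervalIntegral.integral_of_le (by linarith),
    ← intervalIntegral.integral_add_adjacent_intervals (b := 0) (hcont.intervalIntegrable _ _)
      (hcont.intervalIntegrable _ _), hleft, hright, fejerKernel]
  push_cast
  have h2cos : 2 * Complex.cos (l * x) = Complex.exp (c * l) + Complex.exp (-(c * l)) := by
    rw [Complex.two_cos, add_comm, hc]
    ring_nf
  have hc2 : c ^ 2 = -(x : ℂ) ^ 2 := by
    rw [hc, neg_sq, mul_pow, Complex.I_sq]; ring
  have hx0 : (x : ℂ) ≠ 0 := by exact_mod_cast hx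
  rw [mul_sub, h2cos, hc2]
  field_simp
  ring

lemma integral_comp_add_div_mul_fejerKernel (w : ℝ → ℝ) (v : ℝ) {l : ℝ} (hl : 0 < l) :
    ∫ x, w (v + x / l) * fejerKernel x = ∫ u, w u * (l * fejerKernel (l * (u - v))) := by
  have h1 := Measure.integral_comp_div
    (fun y ↦ w (v + y) * (l * fejerKernel (l * (v + y - v)))) l
  have h2 := integral_add_left_eq_self (μ := volume)
    (fun u ↦ w u * (l * fejerKernel (l * (u - v)))) v
  rw [h2, abs_of_pos hl, smul_eq_mul] at h1
  have h3 : ∀ x, w (v + x / l) * (l * fejerKernel (l * (v + x / l - v))) =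
      l * (w (v + x / l) * fejerKernel x) := fun x ↦ by
    rw [add_sub_cancel_left, mul_div_cancel₀ _ hl.ne']; ring
  simp only [h3] at h1
  rw [integral_const_mul] at h1
  exact mul_left_cancel₀ hl.ne' h1

lemma tendsto_average_indicator (l : ℝ) :
    Tendsto (fun v ↦ ∫ x, (Ioi (0 : ℝ)).indicator 1 (v + x / l) * fejerKernel x) atTop
      (𝓝 (∫ x, fejerKernel x)) := by
  refine tendsto_integral_filter_of_dominated_convergence fejerKernel ?_ ?_
    integrable_fejerKernel ?_
  · refine Eventually.of_forall fun v ↦ Measurable.aestronglyMeasurable ?_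
    exact ((measurable_one.indicator measurableSet_Ioi).comp
      (by fun_prop : Measurable fun x ↦ v + x / l)).mul measurable_fejerKernel
  · refine Eventually.of_forall fun v ↦ Eventually.of_forall fun x ↦ ?_
    rw [norm_mul, Real.norm_of_nonneg (fejerKernel_nonneg x)]
    refine mul_le_of_le_one_left (fejerKernel_nonneg x) ?_
    by_cases h : v + x / l ∈ Ioi (0 : ℝ)
    · simp [indicator_of_mem h]
    · simp [indicator_of_notMem h]
  · refine Eventually.of_forall fun x ↦ tendsto_nhds_of_eventually_eq ?_
    filter_upwards [eventually_gt_atTop (-(x / l))] with v hv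
    rw [indicator_of_mem (by simp only [mem_Ioi]; linarith)]
    simp

lemma tendsto_average_psiRatio {l : ℝ} (hl : 0 < l) :
    Tendsto (fun v ↦ ∫ x, psiRatio (v + x / l) * fejerKernel x) atTop
      (𝓝 (∫ x, fejerKernel x)) := by
  have hkl : Integrable fun x ↦ l * fejerKernel (l * x) :=
    (integrable_fejerKernel.comp_mul_left' hl.ne').const_mul l
  have hbdd (u : ℝ) : |psiRatio u - 1| ≤ Real.log 4 + 4 := by
    have h1 := psiRatio_nonneg u
    have h2 := psiRatio_le u
    have : 0 ≤ Real.log 4 := Real.log_nonneg (by norm_num)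
    rw [abs_le]
    constructor <;> linarith
  have h := tendsto_integral_mul_kernel_zero (measurable_psiRatio.sub_const 1) hbdd
    continuousOn_psiLaplace (fun s hs ↦ integral_psiRatio_sub_one hs)
    (φ := fun t : ℝ ↦ ((1 - |t| / l : ℝ) : ℂ)) (by fun_prop) (R := l) hkl.ofReal
    (fun x hx ↦ integral_triangle_mul_exp hl hx)
  have hreal : Tendsto (fun v ↦ ∫ u in Ioi (0 : ℝ),
      (psiRatio u - 1) * (l * fejerKernel (l * (u - v)))) atTop (𝓝 0) := by
    rw [← Filter.tendsto_ofReal_iff]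
    refine (by simpa using h : Tendsto _ _ _).congr fun v ↦ ?_
    rw [← integral_complex_ofReal]
    refine integral_congr_ae (Eventually.of_forall fun u ↦ ?_)
    push_cast
    ring
  have hsum := hreal.add (tendsto_average_indicator l)
  rw [zero_add] at hsum
  refine hsum.congr fun v ↦ ?_
  rw [integral_comp_add_div_mul_fejerKernel _ v hl, integral_comp_add_div_mul_fejerKernel _ v hl,
    ← integral_indicator measurableSet_Ioi]
  have hint : Integrable fun u ↦ l * fejerKernel (l * (u - v)) := hkl.comp_sub_right v
  rw [← integral_add]
  · refine integral_congr_ae (Eventually.of_forall fun u ↦ ?_)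
    by_cases hu : u ∈ Ioi (0 : ℝ)
    · simp only [indicator_of_mem hu, Pi.one_apply]
      ring
    · simp only [indicator_of_notMem hu]
      rw [psiRatio_of_nonpos (not_lt.1 hu)]
      ring
  · refine Integrable.indicator ?_ measurableSet_Ioi
    exact hint.bdd_mul (measurable_psiRatio.sub_const 1).aestronglyMeasurable
      (Eventually.of_forall hbdd)
  · refine hint.bdd_mul (c := 1)
      (measurable_one.indicator measurableSet_Ioi).aestronglyMeasurable
      (Eventually.of_forall fun u ↦ ?_)
    by_cases h : u ∈ Ioi (0 : ℝ)
    · simp [indicator_of_mem h]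
    · simp [indicator_of_notMem h]

lemma tendsto_psiRatio : Tendsto psiRatio atTop (𝓝 1) := by
  have hI := integral_fejerKernel_pos
  refine tendsto_one_of_tendsto_average (k := fun x ↦ fejerKernel x / ∫ y, fejerKernel y)
    measurable_psiRatio psiRatio_nonneg psiRatio_le (fun u w ↦ psiRatio_mul_exp_neg_le u)
    (fun x ↦ div_nonneg (fejerKernel_nonneg x) hI.le) (integrable_fejerKernel.div_const _) ?_
    fun l hl ↦ ?_
  · rw [integral_div, div_self hI.ne']
  · simp only [← mul_div_assoc, integral_div]
    simpa [hI.ne'] using (tendsto_average_psiRatio hl).div_const (∫ x, fejerKernel x)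

/-- The prime number theorem for `ψ`. -/
theorem tendsto_psi_div_self : Tendsto (fun x ↦ Chebyshev.psi x / x) atTop (𝓝 1) := by
  refine (tendsto_psiRatio.comp Real.tendsto_log_atTop).congr' ?_
  filter_upwards [eventually_gt_atTop 0] with x hx
  simp [psiRatio, Real.exp_neg, Real.exp_log hx, div_eq_mul_inv]

/-- The prime number theorem for `θ`. -/
theorem tendsto_theta_div_self : Tendsto (fun x ↦ Chebyshev.theta x / x) atTop (𝓝 1) := by
  have h : Tendsto (fun x ↦ (Chebyshev.psi x - Chebyshev.theta x) / x) atTop (𝓝 0) := by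
    refine Asymptotics.IsLittleO.tendsto_div_nhds_zero ?_
    refine Chebyshev.isBigO_psi_sub_theta_sqrt.trans_isLittleO ?_
    refine Asymptotics.isLittleO_of_tendsto' ?_ ?_
    · filter_upwards [eventually_gt_atTop 0] with x hx h0
      exact absurd h0 hx.ne'
    · refine Real.tendsto_sqrt_atTop.inv_tendsto_atTop.congr fun x ↦ ?_
      rw [Pi.inv_apply, Real.sqrt_div_self', one_div]
  have := tendsto_psi_div_self.sub h
  rw [sub_zero] at this
  refine this.congr fun x ↦ ?_
  ring

/-- The prime number theorem. -/
theorem tendsto_primeCounting_mul_log_div_self :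
    Tendsto (fun x : ℝ ↦ (Nat.primeCounting ⌊x⌋₊ : ℝ) * Real.log x / x) atTop (𝓝 1) := by
  have h : Tendsto (fun x : ℝ ↦ ((Nat.primeCounting ⌊x⌋₊ : ℝ) -
      Chebyshev.theta x / Real.log x) / (x / Real.log x)) atTop (𝓝 0) := by
    refine Asymptotics.IsLittleO.tendsto_div_nhds_zero ?_
    refine Chebyshev.primeCounting_sub_theta_div_log_isBigO.trans_isLittleO ?_
    refine Asymptotics.isLittleO_of_tendsto' ?_ ?_
    · filter_upwards [eventually_gt_atTop 1] with x hx h0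
      have := Real.log_pos hx
      exact absurd h0 (by positivity)
    · refine Real.tendsto_log_atTop.inv_tendsto_atTop.congr' ?_
      filter_upwards [eventually_gt_atTop 1] with x hx
      have := Real.log_pos hx
      simp only [Pi.inv_apply]
      field_simp
  have h2 := h.add tendsto_theta_div_self
  rw [zero_add] at h2
  refine h2.congr' ?_
  filter_upwards [eventually_gt_atTop 1] with x hx
  have := Real.log_pos hx
  field_simp
  ring

/-- The number of primes in `(x/2, x]` is asymptotic to `x / (2 log x)`. -/
lemma tendsto_primeCounting_sub_half :
    Tendsto (fun n : ℕ ↦ ((n.primeCounting - (n / 2).primeCounting : ℕ) : ℝ) *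
      Real.log n / n) atTop (𝓝 (1 / 2)) := by
  have h1 := tendsto_primeCounting_mul_log_div_self.comp tendsto_natCast_atTop_atTop
  have hhalf : Tendsto (fun n : ℕ ↦ (n : ℝ) / 2) atTop atTop :=
    tendsto_natCast_atTop_atTop.atTop_div_const two_pos
  have h2 := tendsto_primeCounting_mul_log_div_self.comp hhalf
  have h3 : Tendsto (fun n : ℕ ↦ 1 + Real.log 2 / Real.log ((n : ℝ) / 2)) atTop (𝓝 1) := by
    simpa using ((Real.tendsto_log_atTop.comp hhalf).const_div_atTop (Real.log 2)).const_add 1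
  have h4 := h1.sub ((h2.mul h3).div_const 2)
  norm_num at h4
  refine (by norm_num; exact h4 : Tendsto _ _ _).congr' ?_
  filter_upwards [eventually_gt_atTop 2] with n hn
  have hn' : (2 : ℝ) < n := by exact_mod_cast hn
  have hlog : 0 < Real.log ((n : ℝ) / 2) := Real.log_pos (by linarith)
  have hfl : ⌊(n : ℝ) / 2⌋₊ = n / 2 := Nat.floor_div_ofNat (n : ℝ) 2 |>.trans (by simp)
  rw [Nat.cast_sub (Nat.monotone_primeCounting (Nat.div_le_self n 2))]
  have hlogn : Real.log n = Real.log ((n : ℝ) / 2) + Real.log 2 := by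
    rw [← Real.log_mul (by positivity) (by norm_num)]
    congr 1
    ring
  simp only [hfl, hlogn]
  field_simp

lemma tendsto_primeCounting_sub_half_atTop :
    Tendsto (fun n : ℕ ↦ n.primeCounting - (n / 2).primeCounting) atTop atTop := by
  rw [← tendsto_natCast_atTop_iff (R := ℝ)]
  have hlog : Tendsto (fun n : ℕ ↦ (n : ℝ) / Real.log n) atTop atTop := by
    have h := Real.isLittleO_log_id_atTop.tendsto_div_nhds_zero.comp
      (tendsto_natCast_atTop_atTop (R := ℝ))
    have h' : Tendsto (fun n : ℕ ↦ Real.log n / n) atTop (𝓝[>] 0) := by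
      refine tendsto_nhdsWithin_iff.2 ⟨h, ?_⟩
      filter_upwards [eventually_gt_atTop 1] with n hn
      have hn' : (1 : ℝ) < n := by exact_mod_cast hn
      have := Real.log_pos hn'
      exact mem_Ioi.2 (by positivity)
    refine h'.inv_tendsto_nhdsGT_zero.congr fun n ↦ ?_
    simp
  refine (tendsto_primeCounting_sub_half.pos_mul_atTop (by norm_num) hlog).congr' ?_
  filter_upwards [eventually_gt_atTop 1] with n hn
  have hn' : (1 : ℝ) < n := by exact_mod_cast hn
  have := Real.log_pos hn'
  field_simp

lemma ramanujan_spec (n : ℕ) {x : ℕ} (hx : ramanujan n ≤ x) :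
    n ≤ x.primeCounting - (x / 2).primeCounting := by
  obtain ⟨N, hN⟩ := eventually_atTop.1 (tendsto_primeCounting_sub_half_atTop.eventually_ge_atTop n)
  have hne : {R : ℕ | 0 < R ∧
      ∀ x : ℕ, R ≤ x → n ≤ x.primeCounting - (x / 2).primeCounting}.Nonempty :=
    ⟨N + 1, N.succ_pos, fun x hx ↦ hN x (by omega)⟩
  exact (Nat.sInf_mem hne).2 x hx

theorem ramanujan_lower_asymptotic (ε : ℝ) (hε₀ : 0 < ε) (hε₂ : ε < 2) :
    ∃ n₀ : ℕ, 0 < n₀ ∧ ∀ n : ℕ, n₀ ≤ n →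
      (ramanujan n : ℝ) > (2 - ε) * n * Real.log n := by
  have hc : 0 < 2 - ε := by linarith
  have hlogn : Tendsto (fun n : ℕ ↦ Real.log n) atTop atTop :=
    Real.tendsto_log_atTop.comp tendsto_natCast_atTop_atTop
  have hx : Tendsto (fun n : ℕ ↦ ⌊(2 - ε) * n * Real.log n⌋₊) atTop atTop :=
    tendsto_nat_floor_atTop.comp
      ((tendsto_natCast_atTop_atTop.const_mul_atTop hc).atTop_mul_atTop₀ hlogn)
  have hev := hx.eventually (tendsto_primeCounting_sub_half.eventually_lt_const
    (show (1 / 2 : ℝ) < 1 / (2 - ε) by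
      rw [div_lt_div_iff₀ two_pos hc]; linarith))
  obtain ⟨n₀, hn₀⟩ := eventually_atTop.1 (hev.and ((hlogn.eventually_ge_atTop (2 / (2 - ε))).and
    (eventually_gt_atTop 1)))
  refine ⟨n₀ + 1, n₀.succ_pos, fun n hn ↦ ?_⟩
  obtain ⟨h1, h2, h3⟩ := hn₀ n (by omega)
  by_contra! hR
  have hspec : (n : ℝ) ≤ _ := Nat.cast_le.2 (ramanujan_spec n (Nat.le_floor hR))
  set x := ⌊(2 - ε) * n * Real.log n⌋₊ with hxdef
  have hn1 : (1 : ℝ) < n := by exact_mod_cast h3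
  have hL : 0 < Real.log n := Real.log_pos hn1
  have hxle : (x : ℝ) ≤ (2 - ε) * n * Real.log n := Nat.floor_le (by positivity)
  have hnx : (n : ℝ) ≤ x := by
    have : (n : ℝ) * 2 ≤ (2 - ε) * n * Real.log n := by
      rw [div_le_iff₀ hc] at h2
      nlinarith
    exact_mod_cast Nat.le_floor (by linarith : (n : ℝ) ≤ (2 - ε) * n * Real.log n)
  have hx0 : (0 : ℝ) < x := by linarith
  have hLx : Real.log n ≤ Real.log x := Real.log_le_log (by linarith) hnx
  rw [div_lt_div_iff₀ hx0 hc] at h1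
  have h4 : (n : ℝ) * Real.log n ≤
      ((x.primeCounting - (x / 2).primeCounting : ℕ) : ℝ) * Real.log x := by
    gcongr
  nlinarith [mul_le_mul_of_nonneg_right h4 hc.le]
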